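/- Let T be a nonempty linearly ordered set. The following conditions are equivalent: (a) there exists a commutative integral domain A that is a valuation ring such that Spec(A), ordered by inclusion, is order-isomorphic to T; (b) T is a Dedekind totally ordered set, i.e., there exists a linearly ordered set U such that T is order-isomorphic to D(U); (c) T satisfies (K1) and (K2). -/

import Mathlib

universe u

/-- A poset satisfies (K1) if every nonempty totally ordered subset has an
infimum and a supremum. -/
def K1p (S : Type*) [Preorder S] : Prop :=
  ∀ C : Set S, C.Nonempty → IsChain (· ≤ ·) C → (∃ a, IsGLB C a) ∧ (∃ b, IsLUB C b)

/-- A poset satisfies (K2) if between any two strictly comparable elements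
there exist immediate neighbors. -/
def K2p (S : Type*) [Preorder S] : Prop :=
  ∀ a b : S, a < b → ∃ c d : S, a ≤ c ∧ c < d ∧ d ≤ b ∧ ¬∃ e, c < e ∧ e < d


lemma K1p_congr {S T : Type*} [Preorder S] [Preorder T] (e : S ≃o T) (h : K1p S) : K1p T := by
  intro C hC hch
  obtain ⟨⟨a, ha⟩, ⟨b, hb⟩⟩ := h (e.symm '' C) (hC.image _) (by
    rintro _ ⟨x, hx, rfl⟩ _ ⟨y, hy, rfl⟩ hne
    have := hch hx hy (fun h => hne (by rw [h]))
    simpa using this)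
  refine ⟨⟨e a, ?_⟩, ⟨e b, ?_⟩⟩
  · rw [← e.symm.isGLB_image']
    · simpa using ha
  · rw [← e.symm.isLUB_image']
    · simpa using hb

lemma K2p_congr {S T : Type*} [Preorder S] [Preorder T] (e : S ≃o T) (h : K2p S) : K2p T := by
  intro a b hab
  obtain ⟨c, d, h1, h2, h3, h4⟩ := h (e.symm a) (e.symm b) (by simpa using hab)
  refine ⟨e c, e d, by simpa using e.monotone h1, by simpa using h2, by simpa using e.monotone h3, ?_⟩
  rintro ⟨x, hx1, hx2⟩
  exact h4 ⟨e.symm x, by simpa using e.symm.strictMono hx1, by simpa using e.symm.strictMono hx2⟩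

lemma lowerSet_K (U : Type*) [LinearOrder U] : K1p (LowerSet U) ∧ K2p (LowerSet U) := by
  refine ⟨fun C _ _ => ⟨⟨sInf C, isGLB_sInf C⟩, ⟨sSup C, isLUB_sSup C⟩⟩, ?_⟩
  intro a b hab
  obtain ⟨x, hxb, hxa⟩ := Set.exists_of_ssubset (LowerSet.coe_ssubset_coe.2 hab)
  refine ⟨LowerSet.Iio x, LowerSet.Iic x, ?_, ?_, ?_, ?_⟩
  · intro y hy
    exact lt_of_not_ge fun h => hxa (a.lower h hy)
  · refine lt_of_le_of_ne (fun y hy => le_of_lt hy) fun h => ?_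
    have : x ∈ LowerSet.Iio x := by rw [h]; simp
    simp at this
  · intro y hy
    exact b.lower hy hxb
  · rintro ⟨e, he1, he2⟩
    by_cases hx : x ∈ e
    · exact he2.not_ge fun y hy => e.lower hy hx
    · refine he1.not_ge fun y hy => ?_
      exact lt_of_not_ge fun h => hx (e.lower h hy)

lemma exists_lowerSet {T : Type*} [LinearOrder T] [Nonempty T] (h1 : K1p T) (h2 : K2p T) :
    Nonempty (T ≃o LowerSet {d : T // ∃ c, c < d ∧ ¬ ∃ e, c < e ∧ e < d}) := by
  have hch : ∀ C : Set T, IsChain (· ≤ ·) C := fun C x _ y _ _ => le_total x y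
  obtain ⟨bot, hbot⟩ := (h1 Set.univ Set.univ_nonempty (hch _)).1
  let f : T → LowerSet {d : T // ∃ c, c < d ∧ ¬ ∃ e, c < e ∧ e < d} := fun t =>
    ⟨{u | u.1 ≤ t}, fun a b hab ha => le_trans (show b.1 ≤ a.1 from hab) ha⟩
  have hle : ∀ a b, f a ≤ f b ↔ a ≤ b := by
    intro a b
    constructor
    · intro h
      by_contra hlt
      obtain ⟨c, d, hc, hcd, hd, hn⟩ := h2 b a (not_le.1 hlt)
      have : d ≤ b := @h ⟨d, c, hcd, hn⟩ hd
      exact absurd (hcd.trans_le this) (not_lt.2 hc)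
    · intro h u hu
      exact le_trans (show u.1 ≤ a from hu) h
  have hsurj : Function.Surjective f := by
    intro L
    obtain ⟨s, hs⟩ : ∃ s, IsLUB (insert bot (Subtype.val '' (L.carrier))) s :=
      (h1 _ (Set.insert_nonempty _ _) (hch _)).2
    refine ⟨s, ?_⟩
    ext u
    constructor
    · intro hu
      obtain ⟨c, hcu, hn⟩ := u.2
      obtain ⟨l, hl, hcl⟩ := (lt_isLUB_iff hs).1 (hcu.trans_le hu)
      rcases hl with rfl | ⟨l, hl, rfl⟩
      · exact absurd (hbot.1 (Set.mem_univ c)) (not_le.2 hcl)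
      · exact L.lower (show u.1 ≤ l.1 from le_of_not_gt fun h => hn ⟨_, hcl, h⟩) hl
    · intro hu
      exact hs.1 (Or.inr ⟨u, hu, rfl⟩)
  exact ⟨{ Equiv.ofBijective f ⟨fun a b h => le_antisymm ((hle _ _).1 h.le) ((hle _ _).1 h.ge), hsurj⟩ with
    map_rel_iff' := fun {a b} => hle a b }⟩

lemma spec_glb {A : Type*} [CommRing A] (C : Set (PrimeSpectrum A)) (hC : C.Nonempty)
    (hch : IsChain (· ≤ ·) C) :
    ∃ a, IsGLB C a ∧ ∀ x, (∀ r ∈ C, x ∈ r.asIdeal) → x ∈ a.asIdeal := by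
  let I : Ideal A := sInf (PrimeSpectrum.asIdeal '' C)
  have hm : ∀ x, x ∈ I ↔ ∀ r ∈ C, x ∈ r.asIdeal := by
    intro x; simp [I, Ideal.mem_sInf]
  have hp : I.IsPrime := by
    refine ⟨?_, ?_⟩
    · rw [Ne, Ideal.eq_top_iff_one, hm]
      obtain ⟨r, hr⟩ := hC
      exact fun h => (Ideal.ne_top_iff_one _).1 r.2.ne_top (h r hr)
    · intro x y hxy
      by_contra! hcon
      obtain ⟨hx, hy⟩ := hcon
      rw [hm] at hx hy hxy
      push Not at hx hy
      obtain ⟨r, hr, hxr⟩ := hx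
      obtain ⟨s, hs, hys⟩ := hy
      rcases hch.total hr hs with h | h
      · exact ((r.2.mem_or_mem (hxy r hr)).elim hxr fun hh => hys (h hh))
      · exact ((s.2.mem_or_mem (hxy s hs)).elim (fun hh => hxr (h hh)) hys)
  refine ⟨⟨I, hp⟩, ⟨?_, ?_⟩, fun x hx => (hm x).2 hx⟩
  · intro r hr x hx
    exact (hm x).1 hx r hr
  · intro b hb x hx
    exact (hm x).2 fun r hr => hb hr hx

lemma spec_lub {A : Type*} [CommRing A] (C : Set (PrimeSpectrum A)) (hC : C.Nonempty)
    (hch : IsChain (· ≤ ·) C) :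
    ∃ a, IsLUB C a ∧ ∀ x, x ∈ a.asIdeal → (∃ r ∈ C, x ∈ r.asIdeal) := by
  let I : Ideal A := sSup (PrimeSpectrum.asIdeal '' C)
  have hm : ∀ x, x ∈ I ↔ ∃ r ∈ C, x ∈ r.asIdeal := by
    intro x
    have hd : DirectedOn (· ≤ ·) (PrimeSpectrum.asIdeal '' C) := by
      rintro _ ⟨r, hr, rfl⟩ _ ⟨s, hs, rfl⟩
      rcases hch.total hr hs with h | h
      · exact ⟨_, ⟨s, hs, rfl⟩, h, le_rfl⟩
      · exact ⟨_, ⟨r, hr, rfl⟩, le_rfl, h⟩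
    have := Submodule.mem_sSup_of_directed (hC.image _) hd (z := x)
    simpa [I] using this
  have hp : I.IsPrime := by
    refine ⟨?_, ?_⟩
    · rw [Ne, Ideal.eq_top_iff_one, hm]
      rintro ⟨r, hr, h⟩
      exact (Ideal.ne_top_iff_one _).1 r.2.ne_top h
    · intro x y hxy
      obtain ⟨r, hr, h⟩ := (hm _).1 hxy
      rcases r.2.mem_or_mem h with h | h
      · exact Or.inl ((hm _).2 ⟨r, hr, h⟩)
      · exact Or.inr ((hm _).2 ⟨r, hr, h⟩)
  refine ⟨⟨I, hp⟩, ⟨?_, ?_⟩, fun x hx => (hm x).1 hx⟩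
  · intro r hr x hx
    exact (hm x).2 ⟨r, hr, hx⟩
  · intro b hb x hx
    obtain ⟨r, hr, h⟩ := (hm x).1 hx
    exact hb hr h

lemma spec_K (A : Type*) [CommRing A] [IsDomain A] [ValuationRing A] :
    K1p (PrimeSpectrum A) ∧ K2p (PrimeSpectrum A) := by
  refine ⟨fun C hC hch => ⟨(spec_glb C hC hch).imp fun _ h => h.1,
    (spec_lub C hC hch).imp fun _ h => h.1⟩, ?_⟩
  have htot : ∀ p q : PrimeSpectrum A, p ≤ q ∨ q ≤ p := fun p q =>
    (ValuationRing.le_total_ideal (A := A)).total p.asIdeal q.asIdeal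
  intro p q hpq
  obtain ⟨x, hxq, hxp⟩ := SetLike.exists_of_lt (show p.asIdeal < q.asIdeal from hpq)
  obtain ⟨c, hc, hc'⟩ := spec_lub {r : PrimeSpectrum A | x ∉ r.asIdeal} ⟨p, hxp⟩
    (fun a _ b _ _ => htot a b)
  obtain ⟨d, hd, hd'⟩ := spec_glb {r : PrimeSpectrum A | x ∈ r.asIdeal} ⟨q, hxq⟩
    (fun a _ b _ _ => htot a b)
  have hxc : x ∉ c.asIdeal := fun h => by
    obtain ⟨r, hr, hr'⟩ := hc' x h
    exact hr hr'
  have hxd : x ∈ d.asIdeal := hd' x fun r hr => hr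
  refine ⟨c, d, hc.1 hxp, ?_, hd.1 hxq, ?_⟩
  · rcases htot c d with h | h
    · exact lt_of_le_of_ne h fun h => hxc (h ▸ hxd)
    · exact absurd (h hxd) hxc
  · rintro ⟨e, h1, h2⟩
    by_cases hx : x ∈ e.asIdeal
    · exact h2.not_ge (hd.1 hx)
    · exact h1.not_ge (hc.1 hx)

lemma spec_iso {A U : Type*} [CommRing A] [IsDomain A] [ValuationRing A] [LinearOrder U]
    (s : U → A) (hu : ∀ u, ¬ IsUnit (s u)) (h0 : ∀ u, s u ≠ 0)
    (h1 : ∀ u w, u < w → ∀ n : ℕ, s w ^ n ∣ s u)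
    (h2 : ∀ x : A, x ≠ 0 → ¬ IsUnit x → ∃ (u : U) (n m : ℕ), s u ∣ x ^ n ∧ x ∣ s u ^ m) :
    Nonempty (PrimeSpectrum A ≃o LowerSet U) := by
  let f : PrimeSpectrum A → LowerSet U := fun P =>
    ⟨{u | s u ∈ P.asIdeal}, fun a b hab ha => by
      rcases hab.eq_or_lt with rfl | h
      · exact ha
      · have := h1 b a h 1
        rw [pow_one] at this
        exact P.asIdeal.mem_of_dvd this ha⟩
  have hf : ∀ P u, u ∈ f P ↔ s u ∈ P.asIdeal := fun P u => Iff.rfl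
  have hle : ∀ P Q, f P ≤ f Q ↔ P ≤ Q := by
    intro P Q
    constructor
    · intro h x hx
      by_cases hx0 : x = 0
      · subst hx0; exact Q.asIdeal.zero_mem
      obtain ⟨u, n, m, hn, hm⟩ := h2 x hx0 fun hxu =>
        P.2.ne_top (Ideal.eq_top_of_isUnit_mem _ hx hxu)
      have h3 : s u ∈ P.asIdeal := P.2.mem_of_pow_mem _ (P.asIdeal.mem_of_dvd hm hx)
      have h4 : s u ∈ Q.asIdeal := h h3
      exact Q.2.mem_of_pow_mem _ (Q.asIdeal.mem_of_dvd hn h4)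
    · intro h u hu
      exact h hu
  have hsurj : Function.Surjective f := by
    intro L
    let I : Ideal A := Ideal.span (s '' (L : Set U))
    have hI : I ≠ ⊤ := by
      have : I ≤ IsLocalRing.maximalIdeal A := by
        rw [Ideal.span_le]
        rintro _ ⟨u, _, rfl⟩
        exact hu u
      exact fun h => (IsLocalRing.maximalIdeal.isMaximal A).ne_top (top_le_iff.1 (h ▸ this))
    have hp : I.radical.IsPrime := by
      refine ⟨fun h => hI (Ideal.radical_eq_top.1 h), ?_⟩
      intro x y hxy
      obtain ⟨n, hn⟩ := hxy
      rcases ValuationRing.dvd_total x y with h | h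
      · right
        refine ⟨2 * n, I.mem_of_dvd ?_ hn⟩
        rw [pow_mul, pow_two]
        exact pow_dvd_pow_of_dvd (mul_dvd_mul_right h y) n
      · left
        refine ⟨2 * n, I.mem_of_dvd ?_ hn⟩
        rw [pow_mul, pow_two]
        exact pow_dvd_pow_of_dvd (mul_dvd_mul_left x h) n
    refine ⟨⟨I.radical, hp⟩, ?_⟩
    ext w
    change s w ∈ I.radical ↔ w ∈ L
    constructor
    · rintro ⟨n, hn⟩
      by_contra hw
      have hle : I ≤ Ideal.span {s w ^ (n + 1)} := by
        rw [Ideal.span_le]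
        rintro _ ⟨u, hu, rfl⟩
        exact Ideal.mem_span_singleton.2
          (h1 u w (lt_of_not_ge fun h => hw (L.lower h hu)) _)
      have hd := Ideal.mem_span_singleton.1 (hle hn)
      rw [pow_succ] at hd
      have : s w ^ n * s w ∣ s w ^ n * 1 := by simpa using hd
      exact hu w (isUnit_of_dvd_one ((mul_dvd_mul_iff_left (pow_ne_zero n (h0 w))).1 this))
    · intro hw
      exact Ideal.le_radical (Ideal.subset_span ⟨w, hw, rfl⟩)
  exact ⟨{ Equiv.ofBijective f ⟨fun a b h => le_antisymm ((hle _ _).1 h.le) ((hle _ _).1 h.ge), hsurj⟩ with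
    map_rel_iff' := fun {a b} => hle a b }⟩

section Hahn
variable {U : Type u} [LinearOrder U]

lemma lex_nsmul (n : ℕ) (g : Lex (U →₀ ℤ)) (j : U) :
    (ofLex (n • g)) j = n * (ofLex g) j := by
  change (n • ofLex g) j = _
  simp

lemma lex_h1 {u w : U} (h : u < w) (n : ℕ) :
    n • (toLex (Finsupp.single w (1 : ℤ))) < toLex (Finsupp.single u (1 : ℤ)) := by
  rw [Finsupp.Lex.lt_iff]
  refine ⟨u, fun j hj => ?_, ?_⟩
  · simp [lex_nsmul, Finsupp.single_apply, hj.ne', (hj.trans h).ne']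
  · simp [lex_nsmul, Finsupp.single_apply, h.ne']

lemma lex_h2 (g : Lex (U →₀ ℤ)) (hg : 0 < g) : ∃ (u : U) (m : ℕ),
    toLex (Finsupp.single u (1 : ℤ)) ≤ 2 • g ∧ g ≤ m • toLex (Finsupp.single u (1 : ℤ)) := by
  obtain ⟨u, hj, hu⟩ := Finsupp.Lex.lt_iff.1 hg
  simp only [ofLex_zero, Finsupp.coe_zero, Pi.zero_apply] at hj hu
  refine ⟨u, ((ofLex g) u).toNat + 1, le_of_lt ?_, le_of_lt ?_⟩
  · rw [Finsupp.Lex.lt_iff]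
    refine ⟨u, fun j h => ?_, ?_⟩
    · simp [lex_nsmul, Finsupp.single_apply, h.ne', ← hj j h]
    · simp [lex_nsmul]; omega
  · rw [Finsupp.Lex.lt_iff]
    refine ⟨u, fun j h => ?_, ?_⟩
    · simp [lex_nsmul, Finsupp.single_apply, h.ne', ← hj j h]
    · simp [lex_nsmul]

lemma exists_valuationRing (U : Type u) [LinearOrder U] :
    ∃ (A : Type u) (_ : CommRing A) (_ : IsDomain A),
        ValuationRing A ∧ Nonempty (PrimeSpectrum A ≃o LowerSet U) := by
  let G := Lex (U →₀ ℤ)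
  let a : AddValuation (HahnSeries G ℚ) (WithTop G) := HahnSeries.addVal G ℚ
  let v := a.toValuation
  let A := v.valuationSubring
  have hint : v.Integers A := Valuation.valuationSubring.integers v
  have hmem : ∀ x : HahnSeries G ℚ, x ∈ A ↔ 0 ≤ a x := fun x => Iff.rfl
  have hdvd : ∀ x y : A, x ∣ y ↔ a x.1 ≤ a y.1 := fun x y => hint.dvd_iff_le
  have hunit : ∀ x : A, IsUnit x ↔ a x.1 = 0 := fun x => hint.isUnit_iff_valuation_eq_one
  have hs : ∀ u : U, a (HahnSeries.single (toLex (Finsupp.single u (1 : ℤ))) (1 : ℚ)) =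
      ((toLex (Finsupp.single u (1 : ℤ)) : G) : WithTop G) := fun u => by
    simp [a, HahnSeries.addVal_apply]
  have hpos : ∀ u : U, (0 : G) < toLex (Finsupp.single u (1 : ℤ)) := fun u => by
    rw [Finsupp.Lex.lt_iff]
    exact ⟨u, fun j hj => by simp [Finsupp.single_apply, hj.ne'], by simp⟩
  let s : U → A := fun u => ⟨HahnSeries.single (toLex (Finsupp.single u (1 : ℤ))) (1 : ℚ), by
    rw [hmem, hs]; exact_mod_cast (hpos u).le⟩
  have hs' : ∀ u, a (s u).1 = ((toLex (Finsupp.single u (1 : ℤ)) : G) : WithTop G) := hs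
  refine ⟨A, inferInstance, inferInstance, inferInstance, spec_iso s ?_ ?_ ?_ ?_⟩
  · intro u
    rw [hunit, hs']
    exact_mod_cast (hpos u).ne'
  · intro u h
    have := hs' u
    rw [h] at this
    simp at this
  · intro u w h n
    rw [hdvd, hs']
    push_cast
    rw [a.map_pow, hs']
    exact_mod_cast (lex_h1 h n).le
  · intro x hx hxu
    have hx' : x.1 ≠ 0 := fun h => hx (Subtype.ext h)
    have hax : a x.1 = (x.1.order : WithTop G) := HahnSeries.addVal_apply_of_ne hx'
    have hx0 : 0 ≤ a x.1 := (hmem _).1 x.2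
    rw [hunit] at hxu
    have hg : 0 < x.1.order := by
      have := lt_of_le_of_ne hx0 (Ne.symm hxu)
      rw [hax] at this
      exact_mod_cast this
    obtain ⟨u, m, h3, h4⟩ := lex_h2 _ hg
    refine ⟨u, 2, m, ?_, ?_⟩
    · rw [hdvd, hs']
      push_cast
      rw [a.map_pow, hax]
      exact_mod_cast h3
    · rw [hdvd]
      push_cast
      rw [a.map_pow, hax, hs']
      exact_mod_cast h4

end Hahn

theorem stmt15 (T : Type u) [LinearOrder T] [Nonempty T] :
    ((∃ (A : Type u) (_ : CommRing A) (_ : IsDomain A),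
        ValuationRing A ∧ Nonempty (PrimeSpectrum A ≃o T)) ↔
      (∃ (U : Type u) (_ : LinearOrder U), Nonempty (T ≃o LowerSet U))) ∧
    ((∃ (U : Type u) (_ : LinearOrder U), Nonempty (T ≃o LowerSet U)) ↔
      (K1p T ∧ K2p T)) := by
  have hcb : (K1p T ∧ K2p T) →
      (∃ (U : Type u) (_ : LinearOrder U), Nonempty (T ≃o LowerSet U)) :=
    fun h => ⟨_, inferInstance, exists_lowerSet h.1 h.2⟩
  refine ⟨⟨?_, ?_⟩, ⟨?_, hcb⟩⟩
  · rintro ⟨A, _, _, _, ⟨e⟩⟩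
    exact hcb ⟨K1p_congr e (spec_K A).1, K2p_congr e (spec_K A).2⟩
  · rintro ⟨U, _, ⟨e⟩⟩
    obtain ⟨A, i1, i2, i3, ⟨e'⟩⟩ := exists_valuationRing U
    exact ⟨A, i1, i2, i3, ⟨e'.trans e.symm⟩⟩
  · rintro ⟨U, _, ⟨e⟩⟩
    exact ⟨K1p_congr e.symm (lowerSet_K U).1, K2p_congr e.symm (lowerSet_K U).2⟩
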